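/- Let f and g be corner functions, each with at least one node, such that α_f = α_g and β_f = β_g (i.e., ψ_f and ψ_g agree up to a translation of the circle 𝕊). Then f and g are conjugate in PLF⁺([0,1]); indeed, a finite sequence of elementary conjugations applied to f, cyclically permuting its nodes, yields a corner function f' with ψ_{f'} = ψ_g, whence f' = g. -/

import Mathlib

open Set Function

/-- `f` is locally affine at `x`: it agrees with an affine map on a neighbourhood of `x`. -/
def LocallyAffineAt (f : ℝ → ℝ) (x : ℝ) : Prop :=
  ∃ a b : ℝ, ∀ᶠ y in nhds x, f y = a * y + b

/-- `x` is a node of `f`: a point of `(0,1)` at which `f` is not locally affine. -/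
def IsNode (f : ℝ → ℝ) (x : ℝ) : Prop :=
  x ∈ Set.Ioo (0 : ℝ) 1 ∧ ¬ LocallyAffineAt f x

/-- Membership of the group `PLF⁺([0,1])` of orientation-preserving piecewise linear
homeomorphisms of `[0,1]` that are locally affine at all but finitely many points of `(0,1)`.
Such a homeomorphism is modelled as a map `ℝ → ℝ` that equals the identity outside `[0,1]`,
so that composition and (function) inverse model the group structure. -/
structure IsPLF (f : ℝ → ℝ) : Prop where
  map_zero : f 0 = 0
  map_one : f 1 = 1
  strictMonoOn : StrictMonoOn f (Set.Icc 0 1)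
  continuousOn : ContinuousOn f (Set.Icc 0 1)
  surjOn : Set.SurjOn f (Set.Icc 0 1) (Set.Icc 0 1)
  eq_id : ∀ x : ℝ, x ∉ Set.Icc (0 : ℝ) 1 → f x = x
  finite_nodes : {x : ℝ | IsNode f x}.Finite

/-- Membership of `𝓕`: elements of `PLF⁺([0,1])` with `f x > x` on `(0,1)`. -/
def MemF (f : ℝ → ℝ) : Prop :=
  IsPLF f ∧ ∀ x ∈ Set.Ioo (0 : ℝ) 1, x < f x

/-- `f` has at least one node. -/
def HasNode (f : ℝ → ℝ) : Prop := ∃ x, IsNode f x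

/-- The left derivative `f'₋(x)`. -/
noncomputable def leftDeriv (f : ℝ → ℝ) (x : ℝ) : ℝ := derivWithin f (Set.Iic x) x

/-- The right derivative `f'₊(x)`. -/
noncomputable def rightDeriv (f : ℝ → ℝ) (x : ℝ) : ℝ := derivWithin f (Set.Ici x) x

/-- `f*(x) = f'₊(x) / f'₋(x)`. -/
noncomputable def fstar (f : ℝ → ℝ) (x : ℝ) : ℝ := rightDeriv f x / leftDeriv f x

/-- `x_f`, the smallest node of `f` (for `f ∈ 𝓕` with at least one node). -/
noncomputable def firstNode (f : ℝ → ℝ) : ℝ := sInf {x | IsNode f x}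

/-- `y_f`, the largest node of `f`. -/
noncomputable def lastNode (f : ℝ → ℝ) : ℝ := sSup {x | IsNode f x}

/-- `α_f = f'₋(x_f)`. -/
noncomputable def alphaF (f : ℝ → ℝ) : ℝ := leftDeriv f (firstNode f)

/-- `φ_f^a(x) = ∏_{n=0}^∞ f*(fⁿ(x))` (independent of `a` as a formula; `a` only
fixes the domain `[a, f a)`). -/
noncomputable def phi (f : ℝ → ℝ) (x : ℝ) : ℝ := ∏' n : ℕ, fstar f (f^[n] x)

/-- `ψ_f^a(s) = φ_f^a(α_f ^ s * a)`, a function on the circle `𝕊 = [0,1]/(0∼1)`,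
represented by its values for `s ∈ [0,1)`. -/
noncomputable def psiA (f : ℝ → ℝ) (a s : ℝ) : ℝ := phi f (alphaF f ^ s * a)

/-- `ψ_f = ψ_f^{x_f}`. -/
noncomputable def psi (f : ℝ → ℝ) (s : ℝ) : ℝ := psiA f (firstNode f) s

/-- `f` and `g` are conjugate in `PLF⁺([0,1])`: `h f h⁻¹ = g` for some `h` in the group. -/
def IsConjPLF (f g : ℝ → ℝ) : Prop :=
  ∃ h : ℝ → ℝ, IsPLF h ∧ h ∘ f ∘ Function.invFun h = g

/-- A corner function: a member of `𝓕` (with at least one node) all of whose nodes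
lie in `[x_f, f x_f)`. -/
def CornerFun (f : ℝ → ℝ) : Prop :=
  MemF f ∧ HasNode f ∧ ∀ x, IsNode f x → x ∈ Set.Ico (firstNode f) (f (firstNode f))


/-- `f` is affine with slope `a > 0` on the left of `x` and with slope `b > 0` on the right. -/
def HasSlopes (f : ℝ → ℝ) (x a b : ℝ) : Prop :=
  (0 < a ∧ ∀ᶠ y in nhdsWithin x (Set.Iic x), f y = f x + a * (y - x)) ∧
    (0 < b ∧ ∀ᶠ y in nhdsWithin x (Set.Ici x), f y = f x + b * (y - x))

namespace HasSlopes

open Filter Topology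

variable {f g : ℝ → ℝ} {x a b a' b' : ℝ}

lemma comp (hg : HasSlopes g (f x) a' b') (hf : HasSlopes f x a b) :
    HasSlopes (g ∘ f) x (a' * a) (b' * b) := by
  obtain ⟨⟨ha, hfa⟩, ⟨hb, hfb⟩⟩ := hf
  obtain ⟨⟨ha', hga⟩, ⟨hb', hgb⟩⟩ := hg
  have key : ∀ (s : Set ℝ) (k : ℝ), (∀ᶠ y in 𝓝[s] x, f y = f x + k * (y - x)) →
      Tendsto f (𝓝[s] x) (𝓝 (f x)) := by
    intro s k h
    have h1 : Tendsto (fun y => f x + k * (y - x)) (𝓝[s] x) (𝓝 (f x)) := by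
      have : ContinuousAt (fun y => f x + k * (y - x)) x := by fun_prop
      have h2 := this.tendsto
      simp only [sub_self, mul_zero, add_zero] at h2
      exact h2.mono_left nhdsWithin_le_nhds
    exact h1.congr' (h.mono fun y hy => hy.symm)
  refine ⟨⟨mul_pos ha' ha, ?_⟩, ⟨mul_pos hb' hb, ?_⟩⟩
  · have ht : Tendsto f (𝓝[≤] x) (𝓝[≤] f x) := by
      refine tendsto_nhdsWithin_iff.2 ⟨key _ _ hfa, ?_⟩
      filter_upwards [hfa, self_mem_nhdsWithin] with y hy hyx
      have : y ≤ x := hyx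
      simp only [Set.mem_Iic]
      nlinarith
    filter_upwards [hfa, ht.eventually hga] with y hy hy'
    simp only [Function.comp_apply]
    rw [hy', hy]; ring
  · have ht : Tendsto f (𝓝[≥] x) (𝓝[≥] f x) := by
      refine tendsto_nhdsWithin_iff.2 ⟨key _ _ hfb, ?_⟩
      filter_upwards [hfb, self_mem_nhdsWithin] with y hy hyx
      have : x ≤ y := hyx
      simp only [Set.mem_Ici]
      nlinarith
    filter_upwards [hfb, ht.eventually hgb] with y hy hy'
    simp only [Function.comp_apply]
    rw [hy', hy]; ring

lemma congr (hf : HasSlopes f x a b) (h : g =ᶠ[𝓝 x] f) : HasSlopes g x a b := by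
  refine ⟨⟨hf.1.1, ?_⟩, ⟨hf.2.1, ?_⟩⟩
  · filter_upwards [hf.1.2, h.filter_mono nhdsWithin_le_nhds] with y hy hy'
    rw [hy', h.self_of_nhds, hy]
  · filter_upwards [hf.2.2, h.filter_mono nhdsWithin_le_nhds] with y hy hy'
    rw [hy', h.self_of_nhds, hy]

lemma symm (e : ℝ ≃o ℝ) (h : HasSlopes e x a b) : HasSlopes e.symm (e x) a⁻¹ b⁻¹ := by
  obtain ⟨⟨ha, hfa⟩, ⟨hb, hfb⟩⟩ := h
  have hc : Tendsto e.symm (𝓝 (e x)) (𝓝 x) := by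
    have := (e.symm.continuous.tendsto (e x))
    rwa [e.symm_apply_apply] at this
  refine ⟨⟨inv_pos.2 ha, ?_⟩, ⟨inv_pos.2 hb, ?_⟩⟩
  · have ht : Tendsto e.symm (𝓝[≤] (e x)) (𝓝[≤] x) := by
      refine tendsto_nhdsWithin_iff.2 ⟨hc.mono_left nhdsWithin_le_nhds, ?_⟩
      filter_upwards [self_mem_nhdsWithin] with y hy
      exact e.symm_apply_le.2 hy
    filter_upwards [ht.eventually hfa] with y hy
    rw [e.apply_symm_apply] at hy
    rw [e.symm_apply_apply]
    field_simp
    linarith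
  · have ht : Tendsto e.symm (𝓝[≥] (e x)) (𝓝[≥] x) := by
      refine tendsto_nhdsWithin_iff.2 ⟨hc.mono_left nhdsWithin_le_nhds, ?_⟩
      filter_upwards [self_mem_nhdsWithin] with y hy
      exact e.le_symm_apply.2 hy
    filter_upwards [ht.eventually hfb] with y hy
    rw [e.apply_symm_apply] at hy
    rw [e.symm_apply_apply]
    field_simp
    linarith

lemma leftDeriv_eq (h : HasSlopes f x a b) : leftDeriv f x = a := by
  have h1 : HasDerivWithinAt (fun y => f x + a * (y - x)) a (Set.Iic x) x := by
    simpa using ((((hasDerivAt_id x).sub_const x).const_mul a).const_add (f x)).hasDerivWithinAt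
      (s := Set.Iic x)
  exact (h1.congr_of_eventuallyEq h.1.2 (by simp)).derivWithin (uniqueDiffWithinAt_Iic x)

lemma rightDeriv_eq (h : HasSlopes f x a b) : rightDeriv f x = b := by
  have h1 : HasDerivWithinAt (fun y => f x + b * (y - x)) b (Set.Ici x) x := by
    simpa using ((((hasDerivAt_id x).sub_const x).const_mul b).const_add (f x)).hasDerivWithinAt
      (s := Set.Ici x)
  exact (h1.congr_of_eventuallyEq h.2.2 (by simp)).derivWithin (uniqueDiffWithinAt_Ici x)

lemma fstar_eq (h : HasSlopes f x a b) : fstar f x = b / a := by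
  rw [fstar, h.leftDeriv_eq, h.rightDeriv_eq]

lemma locallyAffineAt (h : HasSlopes f x a b) (hab : b / a = 1) : LocallyAffineAt f x := by
  have hba : b = a := by
    have := h.1.1.ne'
    field_simp at hab
    exact hab
  subst hba
  refine ⟨b, f x - b * x, ?_⟩
  rw [← nhdsLE_sup_nhdsGE, eventually_sup]
  exact ⟨h.1.2.mono fun y hy => by rw [hy]; ring, h.2.2.mono fun y hy => by rw [hy]; ring⟩

lemma fstar_eq_one (h : HasSlopes f x a b) (hl : LocallyAffineAt f x) : fstar f x = 1 := by
  obtain ⟨c, d, hcd⟩ := hl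
  have hd : HasDerivAt f c x := by
    have h1 : HasDerivAt (fun y => c * y + d) c x := by
      simpa using ((hasDerivAt_id x).const_mul c).add_const d
    exact h1.congr_of_eventuallyEq hcd
  have h1 : a = c := by
    rw [← h.leftDeriv_eq]
    exact hd.hasDerivWithinAt.derivWithin (uniqueDiffWithinAt_Iic x)
  have h2 : b = c := by
    rw [← h.rightDeriv_eq]
    exact hd.hasDerivWithinAt.derivWithin (uniqueDiffWithinAt_Ici x)
  rw [h.fstar_eq, h1, h2, div_self]
  exact h1 ▸ h.1.1.ne'

lemma const_mul {c : ℝ} (hc : 0 < c) (x : ℝ) : HasSlopes (fun y => c * y) x c c :=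
  ⟨⟨hc, Eventually.of_forall fun y => by ring⟩, ⟨hc, Eventually.of_forall fun y => by ring⟩⟩

/-- A function with one-sided slopes at `x` is locally affine at all other points near `x`. -/
lemma eventually_locallyAffineAt (h : HasSlopes f x a b) :
    ∀ᶠ y in 𝓝 x, y ≠ x → LocallyAffineAt f y := by
  have h1 := h.1.2
  have h2 := h.2.2
  rw [eventually_nhdsWithin_iff] at h1 h2
  filter_upwards [h1.eventually_nhds, h2.eventually_nhds] with y hy1 hy2 hne
  rcases lt_or_gt_of_ne hne with hlt | hgt
  · refine ⟨a, f x - a * x, ?_⟩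
    filter_upwards [hy1, Iio_mem_nhds hlt] with z hz hzx
    rw [hz (Set.mem_Iio.1 hzx).le]; ring
  · refine ⟨b, f x - b * x, ?_⟩
    filter_upwards [hy2, Ioi_mem_nhds hgt] with z hz hzx
    rw [hz (Set.mem_Ioi.1 hzx).le]; ring

end HasSlopes

lemma LocallyAffineAt.exists_affine_Ioo {f : ℝ → ℝ} {l u : ℝ}
    (h : ∀ x ∈ Set.Ioo l u, LocallyAffineAt f x) :
    ∃ a b : ℝ, ∀ x ∈ Set.Ioo l u, f x = a * x + b := by
  have hd : ∀ x ∈ Set.Ioo l u, DifferentiableAt ℝ f x ∧ HasDerivAt (deriv f) 0 x := by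
    intro x hx
    obtain ⟨a, b, hab⟩ := h x hx
    have h1 : ∀ y, HasDerivAt (fun y => a * y + b) a y := fun y => by
      simpa using ((hasDerivAt_id y).const_mul a).add_const b
    refine ⟨((h1 x).congr_of_eventuallyEq hab).differentiableAt, ?_⟩
    refine (hasDerivAt_const x a).congr_of_eventuallyEq ?_
    filter_upwards [hab.eventually_nhds] with y hy
    exact ((h1 y).congr_of_eventuallyEq hy).deriv
  obtain ⟨a, ha⟩ := isOpen_Ioo.exists_is_const_of_deriv_eq_zero (f := deriv f) isPreconnected_Ioo
    (fun x hx => (hd x hx).2.differentiableAt.differentiableWithinAt)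
    (fun x hx => (hd x hx).2.deriv)
  have hd2 : ∀ x ∈ Set.Ioo l u, HasDerivAt (fun y => f y - a * y) 0 x := by
    intro x hx
    have h1 : HasDerivAt f a x := by
      rw [← ha x hx]; exact (hd x hx).1.hasDerivAt
    have h2 := h1.sub ((hasDerivAt_id x).const_mul a)
    rw [mul_one, sub_self] at h2
    exact h2
  obtain ⟨b, hb⟩ := isOpen_Ioo.exists_is_const_of_deriv_eq_zero (f := fun y => f y - a * y)
    isPreconnected_Ioo
    (fun x hx => (hd2 x hx).differentiableAt.differentiableWithinAt)
    (fun x hx => (hd2 x hx).deriv)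
  exact ⟨a, b, fun x hx => by linarith [hb x hx]⟩

namespace IsPLF

open Filter Topology

variable {f : ℝ → ℝ}

lemma mem_Icc (hf : IsPLF f) {x : ℝ} (hx : x ∈ Set.Icc (0 : ℝ) 1) : f x ∈ Set.Icc (0 : ℝ) 1 := by
  have h0 := hf.strictMonoOn.monotoneOn (by simp) hx hx.1
  have h1 := hf.strictMonoOn.monotoneOn hx (by simp) hx.2
  rw [hf.map_zero] at h0
  rw [hf.map_one] at h1
  exact ⟨h0, h1⟩

lemma strictMono (hf : IsPLF f) : StrictMono f := by
  intro x y hxy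
  by_cases hx : x ∈ Set.Icc (0 : ℝ) 1 <;> by_cases hy : y ∈ Set.Icc (0 : ℝ) 1
  · exact hf.strictMonoOn hx hy hxy
  · rw [hf.eq_id y hy]
    have h1 := (hf.mem_Icc hx).2
    have : 1 < y := by
      by_contra hc
      exact hy ⟨hx.1.trans hxy.le, not_lt.1 hc⟩
    linarith
  · rw [hf.eq_id x hx]
    have h1 := (hf.mem_Icc hy).1
    have : x < 0 := by
      by_contra hc
      exact hx ⟨not_lt.1 hc, hxy.le.trans hy.2⟩
    linarith
  · rwa [hf.eq_id x hx, hf.eq_id y hy]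

lemma surjective (hf : IsPLF f) : Function.Surjective f := by
  intro y
  by_cases hy : y ∈ Set.Icc (0 : ℝ) 1
  · obtain ⟨x, -, hx⟩ := hf.surjOn hy
    exact ⟨x, hx⟩
  · exact ⟨y, hf.eq_id y hy⟩

lemma continuous (hf : IsPLF f) : Continuous f :=
  hf.strictMono.monotone.continuous_of_surjective hf.surjective

lemma mem_Ioo (hf : IsPLF f) {x : ℝ} (hx : x ∈ Set.Ioo (0 : ℝ) 1) : f x ∈ Set.Ioo (0 : ℝ) 1 := by
  have h0 := hf.strictMono hx.1
  have h1 := hf.strictMono hx.2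
  rw [hf.map_zero] at h0
  rw [hf.map_one] at h1
  exact ⟨h0, h1⟩

lemma iterate_mem_Ioo (hf : IsPLF f) {x : ℝ} (hx : x ∈ Set.Ioo (0 : ℝ) 1) (n : ℕ) :
    f^[n] x ∈ Set.Ioo (0 : ℝ) 1 := by
  induction n with
  | zero => exact hx
  | succ k ih => rw [Function.iterate_succ_apply']; exact hf.mem_Ioo ih

lemma exists_hasSlopes (hf : IsPLF f) {x : ℝ} (hx : x ∈ Set.Ioo (0 : ℝ) 1) :
    ∃ a b, HasSlopes f x a b := by
  have hopen : {y | y ∈ Set.Ioo (0 : ℝ) 1 ∧ y ∉ {y | IsNode f y} \ {x}} ∈ 𝓝 x := by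
    refine Filter.inter_mem (isOpen_Ioo.mem_nhds hx) ?_
    exact (hf.finite_nodes.subset Set.sdiff_subset).isClosed.isOpen_compl.mem_nhds (by simp)
  obtain ⟨l, u, ⟨hlx, hxu⟩, hlu⟩ := mem_nhds_iff_exists_Ioo_subset.1 hopen
  have haff : ∀ y ∈ Set.Ioo l u, y ≠ x → LocallyAffineAt f y := by
    intro y hy hne
    have := hlu hy
    by_contra hc
    exact this.2 ⟨⟨this.1, hc⟩, hne⟩
  obtain ⟨a, c, hac⟩ := LocallyAffineAt.exists_affine_Ioo (l := l) (u := x) (f := f)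
    fun y hy => haff y ⟨hy.1, hy.2.trans hxu⟩ hy.2.ne
  obtain ⟨b, d, hbd⟩ := LocallyAffineAt.exists_affine_Ioo (l := x) (u := u) (f := f)
    fun y hy => haff y ⟨hlx.trans hy.1, hy.2⟩ hy.1.ne'
  have hac' : f x = a * x + c := by
    have h1 : Tendsto f (𝓝[<] x) (𝓝 (f x)) := (hf.continuous.tendsto x).mono_left nhdsWithin_le_nhds
    have h2 : Tendsto (fun y => a * y + c) (𝓝[<] x) (𝓝 (a * x + c)) :=
      (Continuous.tendsto (by fun_prop) x).mono_left nhdsWithin_le_nhds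
    refine tendsto_nhds_unique (h1.congr' ?_) h2
    filter_upwards [Ioo_mem_nhdsLT hlx] with y hy using hac y hy
  have hbd' : f x = b * x + d := by
    have h1 : Tendsto f (𝓝[>] x) (𝓝 (f x)) := (hf.continuous.tendsto x).mono_left nhdsWithin_le_nhds
    have h2 : Tendsto (fun y => b * y + d) (𝓝[>] x) (𝓝 (b * x + d)) :=
      (Continuous.tendsto (by fun_prop) x).mono_left nhdsWithin_le_nhds
    refine tendsto_nhds_unique (h1.congr' ?_) h2
    filter_upwards [Ioo_mem_nhdsGT hxu] with y hy using hbd y hy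
  refine ⟨a, b, ⟨?_, ?_⟩, ⟨?_, ?_⟩⟩
  · obtain ⟨y, hy⟩ := exists_between hlx
    have h1 := hf.strictMono hy.2
    rw [hac y hy, hac'] at h1
    nlinarith [hy.2]
  · filter_upwards [Ioc_mem_nhdsLE hlx] with y hy
    rcases hy.2.eq_or_lt with h | h
    · rw [h]; ring
    · rw [hac y ⟨hy.1, h⟩, hac']; ring
  · obtain ⟨y, hy⟩ := exists_between hxu
    have h1 := hf.strictMono hy.1
    rw [hbd y hy, hbd'] at h1
    nlinarith [hy.1]
  · filter_upwards [Ico_mem_nhdsGE hxu] with y hy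
    rcases hy.1.eq_or_lt with h | h
    · rw [← h]; ring
    · rw [hbd y ⟨h, hy.2⟩, hbd']; ring

lemma fstar_eq_one (hf : IsPLF f) {x : ℝ} (hx : x ∈ Set.Ioo (0 : ℝ) 1) (h : ¬ IsNode f x) :
    fstar f x = 1 := by
  obtain ⟨a, b, hab⟩ := hf.exists_hasSlopes hx
  refine hab.fstar_eq_one ?_
  by_contra hc
  exact h ⟨hx, hc⟩

lemma exists_hasSlopes_iterate (hf : IsPLF f) {x : ℝ} (hx : x ∈ Set.Ioo (0 : ℝ) 1) (n : ℕ) :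
    ∃ a b, HasSlopes f^[n] x a b ∧ b / a = ∏ k ∈ Finset.range n, fstar f (f^[k] x) := by
  induction n with
  | zero =>
    refine ⟨1, 1, ?_, by simp⟩
    simpa using (HasSlopes.const_mul one_pos x).congr
      (g := id) (Filter.Eventually.of_forall fun y => by simp)
  | succ k ih =>
    obtain ⟨a, b, hab, he⟩ := ih
    obtain ⟨a', b', hab'⟩ := hf.exists_hasSlopes (hf.iterate_mem_Ioo hx k)
    refine ⟨a' * a, b' * b, ?_, ?_⟩
    · rw [Function.iterate_succ']
      exact hab'.comp hab
    · rw [Finset.prod_range_succ, ← he, hab'.fstar_eq]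
      have := hab.1.1.ne'
      have := hab'.1.1.ne'
      field_simp

end IsPLF

namespace MemF

open Filter Topology

variable {f : ℝ → ℝ}

lemma id_le (hf : MemF f) : id ≤ f := by
  intro x
  by_cases hx : x ∈ Set.Ioo (0 : ℝ) 1
  · exact (hf.2 x hx).le
  · by_cases hx' : x ∈ Set.Icc (0 : ℝ) 1
    · rcases hx'.1.eq_or_lt with h | h
      · rw [← h, hf.1.map_zero]; rfl
      · rcases hx'.2.eq_or_lt with h' | h'
        · rw [h', hf.1.map_one]; rfl
        · exact absurd ⟨h, h'⟩ hx
    · rw [hf.1.eq_id x hx']; rfl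

lemma eq_self (hf : MemF f) {x : ℝ} (hx : x ∉ Set.Ioo (0 : ℝ) 1) : f x = x := by
  by_cases hx' : x ∈ Set.Icc (0 : ℝ) 1
  · rcases hx'.1.eq_or_lt with h | h
    · rw [← h, hf.1.map_zero]
    · rcases hx'.2.eq_or_lt with h' | h'
      · rw [h', hf.1.map_one]
      · exact absurd ⟨h, h'⟩ hx
  · exact hf.1.eq_id x hx'

lemma le_iterate (hf : MemF f) (n : ℕ) (x : ℝ) : x ≤ f^[n] x :=
  Function.id_le_iterate_of_id_le hf.id_le n x

lemma exists_lt_iterate (hf : MemF f) {δ X : ℝ} (hδ : δ ∈ Set.Ioo (0 : ℝ) 1) (hX : X < 1) :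
    ∃ n, X < f^[n] δ := by
  by_contra! hc
  have hmono : Monotone fun n => f^[n] δ :=
    hf.1.strictMono.monotone.monotone_iterate_of_le_map (hf.id_le δ)
  have ht := tendsto_atTop_ciSup hmono ⟨X, by rintro _ ⟨n, rfl⟩; exact hc n⟩
  have hfix := isFixedPt_of_tendsto_iterate ht hf.1.continuous.continuousAt
  have h1 : δ ≤ ⨆ n, f^[n] δ := hmono.ge_of_tendsto ht 0
  have h2 : ⨆ n, f^[n] δ ≤ X := ciSup_le hc
  exact (hf.2 _ ⟨hδ.1.trans_le h1, h2.trans_lt hX⟩).ne' hfix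

lemma exists_iterate_eq (hf : MemF f) {δ X : ℝ} (hδ : δ ∈ Set.Ioo (0 : ℝ) 1) (hX : X < 1) :
    ∃ n, ∀ x, 0 < x → x ≤ X → ∃ y ∈ Set.Ioo 0 δ, f^[n] y = x := by
  obtain ⟨n, hn⟩ := hf.exists_lt_iterate hδ hX
  refine ⟨n, fun x hx hxX => ?_⟩
  obtain ⟨y, hy⟩ := hf.1.surjective.iterate n x
  have hmono := hf.1.strictMono.iterate n
  refine ⟨y, ⟨?_, ?_⟩, hy⟩
  · rw [← hmono.lt_iff_lt, hy, Function.iterate_fixed hf.1.map_zero]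
    exact hx
  · rw [← hmono.lt_iff_lt, hy]
    exact hxX.trans_lt hn

end MemF

namespace CornerFun

variable {f : ℝ → ℝ}

lemma isNode_firstNode (hf : CornerFun f) : IsNode f (firstNode f) :=
  Set.Nonempty.csInf_mem hf.2.1 hf.1.1.finite_nodes

lemma firstNode_le (hf : CornerFun f) {x : ℝ} (hx : IsNode f x) : firstNode f ≤ x :=
  csInf_le hf.1.1.finite_nodes.bddBelow hx

lemma apply_eq_alphaF_mul (hf : CornerFun f) {y : ℝ} (hy : y ∈ Set.Icc 0 (firstNode f)) :
    f y = alphaF f * y := by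
  have hx := hf.isNode_firstNode.1
  obtain ⟨a, b, hab⟩ := LocallyAffineAt.exists_affine_Ioo (f := f) (l := 0) (u := firstNode f)
    (by
      intro x hx'
      by_contra hc
      exact (hf.firstNode_le ⟨⟨hx'.1, hx'.2.trans hx.2⟩, hc⟩).not_gt hx'.2)
  have hcl : Set.EqOn f (fun y => a * y + b) (closure (Set.Ioo 0 (firstNode f))) :=
    Set.EqOn.closure hab hf.1.1.continuous (by fun_prop)
  rw [closure_Ioo hx.1.ne] at hcl
  have hb : b = 0 := by
    have := hcl ⟨le_rfl, hx.1.le⟩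
    simp only [hf.1.1.map_zero] at this
    linarith
  have hα : alphaF f = a := by
    have h1 : HasDerivWithinAt (fun y => a * y + b) a (Set.Iic (firstNode f)) (firstNode f) := by
      simpa using (((hasDerivAt_id (firstNode f)).const_mul a).add_const b).hasDerivWithinAt
        (s := Set.Iic (firstNode f))
    refine (h1.congr_of_eventuallyEq ?_ (hcl ⟨hx.1.le, le_rfl⟩)).derivWithin
      (uniqueDiffWithinAt_Iic _)
    filter_upwards [Ioc_mem_nhdsLE hx.1] with z hz using hcl ⟨hz.1.le, hz.2⟩
  have hy' : f y = a * y + b := hcl hy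
  rw [hα, hy', hb, add_zero]

lemma one_lt_alphaF (hf : CornerFun f) : 1 < alphaF f := by
  have hx := hf.isNode_firstNode.1
  have h1 := hf.1.2 _ hx
  rw [hf.apply_eq_alphaF_mul ⟨hx.1.le, le_rfl⟩] at h1
  nlinarith [hx.1]

lemma fstar_eq_one_of_lt (hf : CornerFun f) {x : ℝ} (h0 : 0 < x) (h : x < firstNode f) :
    fstar f x = 1 :=
  hf.1.1.fstar_eq_one ⟨h0, h.trans hf.isNode_firstNode.1.2⟩ fun hn => (hf.firstNode_le hn).not_gt h

lemma fstar_eq_one_of_le (hf : CornerFun f) {x : ℝ} (h1 : x < 1) (h : f (firstNode f) ≤ x) :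
    fstar f x = 1 :=
  hf.1.1.fstar_eq_one ⟨(hf.1.1.mem_Ioo hf.isNode_firstNode.1).1.trans_le h, h1⟩
    fun hn => (hf.2.2 x hn).2.not_ge h

/-- Along a forward orbit that starts below the first node and ends beyond all nodes, the product
of the jumps of `f` is the value of `psi f` at the logarithmic coordinate of the orbit. -/
lemma prod_fstar_iterate (hf : CornerFun f) {r : ℝ} {n : ℕ}
    (hr : alphaF f ^ r * firstNode f < firstNode f)
    (hn : f (firstNode f) ≤ f^[n] (alphaF f ^ r * firstNode f)) :
    ∏ k ∈ Finset.range n, fstar f (f^[k] (alphaF f ^ r * firstNode f)) =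
      psi f (Int.fract r) := by
  have hα := hf.one_lt_alphaF
  have hα0 : 0 < alphaF f := one_pos.trans hα
  have hx := hf.isNode_firstNode.1
  have hmono := hf.1.1.strictMono.monotone
  have hfx := hf.apply_eq_alphaF_mul (y := firstNode f) ⟨hx.1.le, le_rfl⟩
  have hfx1 : f (firstNode f) < 1 := (hf.1.1.mem_Ioo hx).2
  have hr0 : r < 0 := by
    have h1 : alphaF f ^ r < 1 := by
      by_contra hc
      nlinarith [hx.1]
    rw [← Real.rpow_zero (alphaF f)] at h1
    exact (Real.rpow_lt_rpow_left_iff hα).1 h1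
  have hfl : ⌊r⌋ < 0 := Int.floor_lt.2 (by simpa using hr0)
  obtain ⟨m, hm⟩ : ∃ m : ℕ, (m : ℤ) = -⌊r⌋ := ⟨(-⌊r⌋).toNat, by omega⟩
  have hs : Int.fract r = r + m := by
    have : (m : ℝ) = -⌊r⌋ := by exact_mod_cast hm
    rw [Int.fract, this]; ring
  have horb : ∀ k ≤ m, f^[k] (alphaF f ^ r * firstNode f) = alphaF f ^ (r + k) * firstNode f := by
    intro k
    induction k with
    | zero => simp
    | succ k ih =>
      intro hk
      have hk' : (k : ℝ) + 1 ≤ m := by exact_mod_cast hk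
      have h1 : alphaF f ^ (r + k) ≤ 1 :=
        Real.rpow_le_one_of_one_le_of_nonpos hα.le (by linarith [Int.fract_lt_one r])
      have h2 : 0 < alphaF f ^ (r + k) := Real.rpow_pos_of_pos hα0 _
      rw [Function.iterate_succ_apply', ih (by omega), hf.apply_eq_alphaF_mul
        ⟨(mul_pos h2 hx.1).le, by nlinarith [hx.1]⟩, Nat.cast_succ, ← add_assoc,
        Real.rpow_add_one hα0.ne']
      ring
  set z := alphaF f ^ Int.fract r * firstNode f with hz
  have hmz : f^[m] (alphaF f ^ r * firstNode f) = z := by rw [horb m le_rfl, hz, hs]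
  have hz1 : firstNode f ≤ z := by
    have := Real.one_le_rpow hα.le (Int.fract_nonneg r)
    nlinarith [hx.1]
  have hz2 : z < f (firstNode f) := by
    have := (Real.rpow_lt_rpow_left_iff hα).2 (Int.fract_lt_one r)
    rw [Real.rpow_one] at this
    rw [hfx]
    exact mul_lt_mul_of_pos_right this hx.1
  have hzI : z ∈ Set.Ioo (0 : ℝ) 1 := ⟨hx.1.trans_le hz1, hz2.trans hfx1⟩
  have hge : ∀ k, f (firstNode f) ≤ f^[k + 1] z := fun k =>
    (hmono hz1).trans (hf.1.le_iterate k _)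
  have hpsi : psi f (Int.fract r) = fstar f z := by
    rw [psi, psiA, phi, ← hz]
    rw [tprod_eq_mulSingle 0]
    · rfl
    · intro k hk
      obtain ⟨k, rfl⟩ := Nat.exists_eq_succ_of_ne_zero hk
      exact hf.fstar_eq_one_of_le (hf.1.1.iterate_mem_Ioo hzI _).2 (hge k)
  have hmn : m < n := by
    by_contra! hc
    have h1 : f^[n] (alphaF f ^ r * firstNode f) ≤ z := by
      rw [← hmz, ← Nat.sub_add_cancel hc, Function.iterate_add_apply]
      exact hf.1.le_iterate _ _
    linarith
  rw [hpsi, Finset.prod_eq_single m]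
  · rw [hmz]
  · intro k _ hkm
    rcases lt_or_gt_of_ne hkm with hlt | hgt
    · rw [horb k hlt.le]
      have hk' : (k : ℝ) + 1 ≤ m := by exact_mod_cast hlt
      have h1 : alphaF f ^ (r + k) < 1 :=
        Real.rpow_lt_one_of_one_lt_of_neg hα (by linarith [Int.fract_lt_one r])
      have h2 : 0 < alphaF f ^ (r + k) := Real.rpow_pos_of_pos hα0 _
      exact hf.fstar_eq_one_of_lt (mul_pos h2 hx.1) (by nlinarith [hx.1])
    · obtain ⟨j, rfl⟩ := Nat.exists_eq_add_of_lt hgt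
      have : f^[m + j + 1] (alphaF f ^ r * firstNode f) = f^[j + 1] z := by
        rw [← hmz, ← Function.iterate_add_apply, show m + j + 1 = j + 1 + m by omega]
      rw [this]
      exact hf.fstar_eq_one_of_le (hf.1.1.iterate_mem_Ioo hzI _).2 (hge j)
  · intro h
    exact absurd (Finset.mem_range.2 hmn) h

end CornerFun

open Classical in
/-- The map that is `y ↦ c * y` on `(0, ε)`, is extended to `(0, 1)` so as to carry the `f`-orbit
of `y` to the `g`-orbit of `c * y`, and is the identity elsewhere. -/
noncomputable def conjMap (f g : ℝ → ℝ) (c ε x : ℝ) : ℝ :=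
  if h : ∃ q : ℕ × ℝ, q.2 ∈ Set.Ioo 0 ε ∧ f^[q.1] q.2 = x then
    g^[h.choose.1] (c * h.choose.2) else x

/-- On `(0, ε)`, multiplication by `c` conjugates `f` to `g`. -/
structure ConjNearZero (f g : ℝ → ℝ) (c ε : ℝ) : Prop where
  left : MemF f
  right : MemF g
  c_pos : 0 < c
  ε_mem : ε ∈ Set.Ioo (0 : ℝ) 1
  mul_lt_one : c * ε < 1
  apply_mul : ∀ y ∈ Set.Ioo 0 ε, g (c * y) = c * f y

namespace ConjNearZero

open Filter Topology

variable {f g : ℝ → ℝ} {c ε : ℝ}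

lemma iterate_mul (H : ConjNearZero f g c ε) {k : ℕ} {y : ℝ} (hy : 0 < y)
    (hk : f^[k] y < ε) : g^[k] (c * y) = c * f^[k] y := by
  induction k generalizing y with
  | zero => rfl
  | succ k ih =>
    have hyε : y < ε := (H.left.le_iterate _ _).trans_lt hk
    rw [Function.iterate_succ_apply] at hk
    rw [Function.iterate_succ_apply, Function.iterate_succ_apply, H.apply_mul y ⟨hy, hyε⟩,
      ih (hy.trans_le (H.left.id_le y)) hk]

lemma iterate_congr (H : ConjNearZero f g c ε) {n n' : ℕ} {y y' : ℝ} (hn : n ≤ n')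
    (hy : y ∈ Set.Ioo 0 ε) (hy' : y' ∈ Set.Ioo 0 ε) (h : f^[n] y = f^[n'] y') :
    g^[n] (c * y) = g^[n'] (c * y') := by
  obtain ⟨k, rfl⟩ := Nat.exists_eq_add_of_le hn
  rw [Function.iterate_add_apply] at h ⊢
  have h2 : y = f^[k] y' := H.left.1.strictMono.injective.iterate n h
  rw [H.iterate_mul hy'.1 (h2 ▸ hy.2), ← h2]

lemma conjMap_iterate (H : ConjNearZero f g c ε) (n : ℕ) {y : ℝ} (hy : y ∈ Set.Ioo 0 ε) :
    conjMap f g c ε (f^[n] y) = g^[n] (c * y) := by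
  have h : ∃ q : ℕ × ℝ, q.2 ∈ Set.Ioo 0 ε ∧ f^[q.1] q.2 = f^[n] y := ⟨(n, y), hy, rfl⟩
  rw [conjMap, dif_pos h]
  rcases le_total h.choose.1 n with hn | hn
  · exact H.iterate_congr hn h.choose_spec.1 hy h.choose_spec.2
  · exact (H.iterate_congr hn hy h.choose_spec.1 h.choose_spec.2.symm).symm

lemma mem_Ioo_left (H : ConjNearZero f g c ε) {y : ℝ} (hy : y ∈ Set.Ioo 0 ε) :
    y ∈ Set.Ioo (0 : ℝ) 1 := ⟨hy.1, hy.2.trans H.ε_mem.2⟩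

lemma mem_Ioo_right (H : ConjNearZero f g c ε) {y : ℝ} (hy : y ∈ Set.Ioo 0 ε) :
    c * y ∈ Set.Ioo (0 : ℝ) 1 :=
  ⟨mul_pos H.c_pos hy.1, (mul_lt_mul_of_pos_left hy.2 H.c_pos).trans H.mul_lt_one⟩

lemma conjMap_of_notMem (H : ConjNearZero f g c ε) {x : ℝ} (hx : x ∉ Set.Ioo (0 : ℝ) 1) :
    conjMap f g c ε x = x := by
  rw [conjMap, dif_neg]
  rintro ⟨q, hq, rfl⟩
  exact hx (H.left.1.iterate_mem_Ioo (H.mem_Ioo_left hq) _)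

lemma exists_iterate_eq (H : ConjNearZero f g c ε) {X : ℝ} (hX : X < 1) :
    ∃ n, ∀ x, 0 < x → x ≤ X → ∃ y ∈ Set.Ioo 0 ε, f^[n] y = x :=
  H.left.exists_iterate_eq H.ε_mem hX

lemma exists_iterate_eq_of_mem (H : ConjNearZero f g c ε) {x : ℝ} (hx : x ∈ Set.Ioo (0 : ℝ) 1) :
    ∃ n, ∃ y ∈ Set.Ioo 0 ε, f^[n] y = x := by
  obtain ⟨n, hn⟩ := H.exists_iterate_eq hx.2
  exact ⟨n, hn x hx.1 le_rfl⟩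

lemma conjMap_mem_Ioo (H : ConjNearZero f g c ε) {x : ℝ} (hx : x ∈ Set.Ioo (0 : ℝ) 1) :
    conjMap f g c ε x ∈ Set.Ioo (0 : ℝ) 1 := by
  obtain ⟨n, y, hy, rfl⟩ := H.exists_iterate_eq_of_mem hx
  rw [H.conjMap_iterate n hy]
  exact H.right.1.iterate_mem_Ioo (H.mem_Ioo_right hy) n

lemma strictMono_conjMap (H : ConjNearZero f g c ε) : StrictMono (conjMap f g c ε) := by
  intro x y hxy
  by_cases hx : x ∈ Set.Ioo (0 : ℝ) 1 <;> by_cases hy : y ∈ Set.Ioo (0 : ℝ) 1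
  · obtain ⟨n, hn⟩ := H.exists_iterate_eq hy.2
    obtain ⟨u, hu, rfl⟩ := hn x hx.1 hxy.le
    obtain ⟨v, hv, rfl⟩ := hn y hy.1 le_rfl
    rw [H.conjMap_iterate n hu, H.conjMap_iterate n hv]
    refine H.right.1.strictMono.iterate n (mul_lt_mul_of_pos_left ?_ H.c_pos)
    exact (H.left.1.strictMono.iterate n).lt_iff_lt.1 hxy
  · rw [H.conjMap_of_notMem hy]
    have h1 := (H.conjMap_mem_Ioo hx).2
    have : 1 ≤ y := by
      by_contra hc
      exact hy ⟨hx.1.trans hxy, not_le.1 hc⟩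
    linarith
  · rw [H.conjMap_of_notMem hx]
    have h1 := (H.conjMap_mem_Ioo hy).1
    have : x ≤ 0 := by
      by_contra hc
      exact hx ⟨not_le.1 hc, hxy.trans hy.2⟩
    linarith
  · rwa [H.conjMap_of_notMem hx, H.conjMap_of_notMem hy]

lemma surjective_conjMap (H : ConjNearZero f g c ε) : Function.Surjective (conjMap f g c ε) := by
  intro z
  by_cases hz : z ∈ Set.Ioo (0 : ℝ) 1
  · obtain ⟨n, hn⟩ := H.right.exists_iterate_eq
      ⟨mul_pos H.c_pos H.ε_mem.1, H.mul_lt_one⟩ hz.2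
    obtain ⟨w, hw, rfl⟩ := hn z hz.1 le_rfl
    refine ⟨f^[n] (w / c), ?_⟩
    rw [H.conjMap_iterate n, mul_div_cancel₀ w H.c_pos.ne']
    exact ⟨div_pos hw.1 H.c_pos, (div_lt_iff₀' H.c_pos).2 hw.2⟩
  · exact ⟨z, H.conjMap_of_notMem hz⟩

lemma conjMap_apply (H : ConjNearZero f g c ε) (x : ℝ) :
    conjMap f g c ε (f x) = g (conjMap f g c ε x) := by
  by_cases hx : x ∈ Set.Ioo (0 : ℝ) 1
  · obtain ⟨n, y, hy, rfl⟩ := H.exists_iterate_eq_of_mem hx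
    rw [← Function.iterate_succ_apply' f, H.conjMap_iterate _ hy, H.conjMap_iterate _ hy,
      Function.iterate_succ_apply']
  · rw [H.left.eq_self hx, H.conjMap_of_notMem hx, H.right.eq_self hx]

lemma exists_hasSlopes_conjMap (H : ConjNearZero f g c ε) (n : ℕ) {y : ℝ}
    (hy : y ∈ Set.Ioo 0 ε) :
    ∃ a b, HasSlopes (conjMap f g c ε) (f^[n] y) a b ∧
      b / a = (∏ k ∈ Finset.range n, fstar g (g^[k] (c * y))) /
        ∏ k ∈ Finset.range n, fstar f (f^[k] y) := by
  obtain ⟨a, b, hab, he⟩ := H.left.1.exists_hasSlopes_iterate (H.mem_Ioo_left hy) n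
  obtain ⟨a', b', hab', he'⟩ := H.right.1.exists_hasSlopes_iterate (H.mem_Ioo_right hy) n
  let e : ℝ ≃o ℝ := (H.left.1.strictMono.iterate n).orderIsoOfSurjective _
    (H.left.1.surjective.iterate n)
  have hs : HasSlopes e.symm (e y) a⁻¹ b⁻¹ := HasSlopes.symm e hab
  have hcy : e.symm (e y) = y := e.symm_apply_apply y
  have h1 : HasSlopes (g^[n] ∘ fun y => c * y) (e.symm (e y)) (a' * c) (b' * c) := by
    rw [hcy]
    exact HasSlopes.comp (f := fun y => c * y) hab' (HasSlopes.const_mul H.c_pos y)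
  have h2 := h1.comp hs
  refine ⟨a' * c * a⁻¹, b' * c * b⁻¹, h2.congr ?_, ?_⟩
  · have ht : Tendsto e.symm (𝓝 (e y)) (𝓝 y) := by
      have := e.symm.continuous.tendsto (e y)
      rwa [hcy] at this
    filter_upwards [ht.eventually (isOpen_Ioo.mem_nhds hy)] with z hz
    have : f^[n] (e.symm z) = z := e.apply_symm_apply z
    rw [← this, H.conjMap_iterate n hz]
    simp only [Function.comp_apply]
    rw [this]
  · rw [← he, ← he']
    have := hab.1.1.ne'
    have := hab.2.1.ne'
    have := hab'.1.1.ne'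
    have := H.c_pos.ne'
    field_simp

lemma isPLF_conjMap (H : ConjNearZero f g c ε) {T : ℝ} (hT : T < 1)
    (haff : ∀ x, T < x → x < 1 → LocallyAffineAt (conjMap f g c ε) x) :
    IsPLF (conjMap f g c ε) where
  map_zero := H.conjMap_of_notMem (by simp)
  map_one := H.conjMap_of_notMem (by simp)
  strictMonoOn := H.strictMono_conjMap.strictMonoOn _
  continuousOn :=
    (H.strictMono_conjMap.monotone.continuous_of_surjective H.surjective_conjMap).continuousOn
  surjOn := by
    intro z hz
    obtain ⟨x, rfl⟩ := H.surjective_conjMap z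
    refine ⟨x, ?_, rfl⟩
    by_contra hx
    rw [H.conjMap_of_notMem fun h => hx ⟨h.1.le, h.2.le⟩] at hz
    exact hx hz
  eq_id x hx := H.conjMap_of_notMem fun h => hx ⟨h.1.le, h.2.le⟩
  finite_nodes := by
    obtain ⟨t, -, ht⟩ := (isCompact_Icc (a := ε) (b := T)).elim_nhds_subcover
      (fun x => {y | y ≠ x → LocallyAffineAt (conjMap f g c ε) y}) (by
        intro x hx
        obtain ⟨n, y, hy, rfl⟩ := H.exists_iterate_eq_of_mem
          ⟨H.ε_mem.1.trans_le hx.1, hx.2.trans_lt hT⟩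
        obtain ⟨a, b, hab, -⟩ := H.exists_hasSlopes_conjMap n hy
        exact hab.eventually_locallyAffineAt)
    refine t.finite_toSet.subset ?_
    rintro y ⟨hy, hn⟩
    have h1 : ε ≤ y := by
      by_contra! hc
      refine hn ⟨c, 0, ?_⟩
      filter_upwards [isOpen_Ioo.mem_nhds (show y ∈ Set.Ioo 0 ε from ⟨hy.1, hc⟩)] with z hz
      simpa using H.conjMap_iterate 0 hz
    have h2 : y ≤ T := by
      by_contra! hc
      exact hn (haff y hc hy.2)
    obtain ⟨x, hx, hxy⟩ := Set.mem_iUnion₂.1 (ht ⟨h1, h2⟩)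
    by_cases h : y = x
    · rw [h]; exact hx
    · exact absurd (hxy h) hn

lemma isConjPLF (H : ConjNearZero f g c ε) {T : ℝ} (hT : T < 1)
    (haff : ∀ x, T < x → x < 1 → LocallyAffineAt (conjMap f g c ε) x) : IsConjPLF f g := by
  refine ⟨conjMap f g c ε, H.isPLF_conjMap hT haff, ?_⟩
  funext z
  obtain ⟨x, rfl⟩ := H.surjective_conjMap z
  simp only [Function.comp_apply]
  rw [Function.leftInverse_invFun H.strictMono_conjMap.injective x, H.conjMap_apply]

end ConjNearZero

lemma CornerFun.isConjPLF {f g : ℝ → ℝ} (hf : CornerFun f) (hg : CornerFun g)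
    (ha : alphaF f = alphaF g) {p : ℝ}
    (hp : ∀ s ∈ Set.Ico (0 : ℝ) 1, psi f s = psi g (Int.fract (s + p))) : IsConjPLF f g := by
  have hxf := hf.isNode_firstNode.1
  have hxg := hg.isNode_firstNode.1
  have hα := hf.one_lt_alphaF
  have hα0 : 0 < alphaF f := one_pos.trans hα
  set c := alphaF f ^ p * firstNode g / firstNode f with hc
  have hc0 : 0 < c := div_pos (mul_pos (Real.rpow_pos_of_pos hα0 p) hxg.1) hxf.1
  set ε := min (firstNode f) (firstNode g / c) with hε
  have hεf : ε ≤ firstNode f := min_le_left _ _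
  have hεg : c * ε ≤ firstNode g := (le_div_iff₀' hc0).1 (min_le_right _ _)
  have H : ConjNearZero f g c ε :=
    { left := hf.1
      right := hg.1
      c_pos := hc0
      ε_mem := ⟨lt_min hxf.1 (div_pos hxg.1 hc0), hεf.trans_lt hxf.2⟩
      mul_lt_one := hεg.trans_lt hxg.2
      apply_mul := by
        intro y hy
        rw [hf.apply_eq_alphaF_mul ⟨hy.1.le, hy.2.le.trans hεf⟩, hg.apply_eq_alphaF_mul
          ⟨(mul_pos hc0 hy.1).le, (mul_lt_mul_of_pos_left hy.2 hc0).le.trans hεg⟩, ha]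
        ring }
  obtain ⟨T, hT⟩ := H.surjective_conjMap (g (firstNode g))
  have hT1 : T < 1 := by
    by_contra hTc
    rw [H.conjMap_of_notMem fun h => hTc h.2] at hT
    exact hTc (hT ▸ (hg.1.1.mem_Ioo hxg).2)
  refine H.isConjPLF (T := max (f (firstNode f)) T) (max_lt (hf.1.1.mem_Ioo hxf).2 hT1) ?_
  intro x hTx hx1
  have hfx : f (firstNode f) < x := (le_max_left _ _).trans_lt hTx
  have hgx : g (firstNode g) < conjMap f g c ε x := by
    rw [← hT]
    exact H.strictMono_conjMap ((le_max_right _ _).trans_lt hTx)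
  obtain ⟨n, y, hy, rfl⟩ := H.exists_iterate_eq_of_mem
    ⟨(hf.1.1.mem_Ioo hxf).1.trans hfx, hx1⟩
  rw [H.conjMap_iterate n hy] at hgx
  obtain ⟨a, b, hab, he⟩ := H.exists_hasSlopes_conjMap n hy
  refine hab.locallyAffineAt ?_
  obtain ⟨r, hr⟩ : ∃ r : ℝ, alphaF f ^ r * firstNode f = y := by
    refine ⟨Real.logb (alphaF f) (y / firstNode f), ?_⟩
    rw [Real.rpow_logb hα0 hα.ne' (div_pos hy.1 hxf.1), div_mul_cancel₀ _ hxf.1.ne']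
  have hcr : alphaF g ^ (r + p) * firstNode g = c * y := by
    rw [← hr, hc, ← ha, Real.rpow_add hα0]
    have := hxf.1.ne'
    field_simp
  have h1 := hf.prod_fstar_iterate (r := r) (n := n) (by rw [hr]; exact hy.2.trans_le hεf)
    (by rw [hr]; exact hfx.le)
  have h2 := hg.prod_fstar_iterate (r := r + p) (n := n)
    (by rw [hcr]; exact (mul_lt_mul_of_pos_left hy.2 hc0).trans_le hεg)
    (by rw [hcr]; exact hgx.le)
  rw [hr] at h1
  rw [hcr] at h2
  have hfr : Int.fract (Int.fract r + p) = Int.fract (r + p) := by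
    have : r + p = Int.fract r + p + (⌊r⌋ : ℤ) := by rw [Int.fract]; ring
    rw [this, Int.fract_add_intCast]
  have h3 : psi f (Int.fract r) = psi g (Int.fract (r + p)) := by
    rw [hp _ ⟨Int.fract_nonneg r, Int.fract_lt_one r⟩, hfr]
  rw [he, h1, h2, h3, div_self]
  rw [← h3, ← h1]
  obtain ⟨a, b, hab, he⟩ := hf.1.1.exists_hasSlopes_iterate (H.mem_Ioo_left hy) n
  rw [← he]
  exact (div_pos hab.2.1 hab.1.1).ne'

/-- Corner functions `f` and `g` with `α_f = α_g` and `β_f = β_g` are conjugate in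
`PLF⁺([0,1])`: indeed some finite sequence of elementary conjugations applied to `f`
(cyclically permuting its nodes) yields a corner function `f'` with `ψ_{f'} = ψ_g`,
whence `f' = g`. -/
theorem corner_conj_of_alpha_beta (f g : ℝ → ℝ)
    (hf : CornerFun f) (hg : CornerFun g)
    (ha : alphaF f = alphaF g)
    (hb : ∃ p : ℝ, ∀ s ∈ Set.Ico (0 : ℝ) 1, psi f s = psi g (Int.fract (s + p))) :
    IsConjPLF f g ∧
    ∃ f' : ℝ → ℝ, CornerFun f' ∧ IsConjPLF f f' ∧
      (∀ s ∈ Set.Ico (0 : ℝ) 1, psi f' s = psi g s) ∧ f' = g := by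
  obtain ⟨p, hp⟩ := hb
  have hconj := hf.isConjPLF hg ha hp
  exact ⟨hconj, g, hg, hconj, fun _ _ => rfl, rfl⟩
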